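/- The index of the special linear Lie algebra sl(n+1,ℂ) equals n: the minimum, over all linear functionals f on sl(n+1,ℂ), of dim_ℂ ker(B_f) is exactly n. -/

import Mathlib

open Matrix

/-- The kernel of the Kirillov form `B_f(x, y) = f ⁅x, y⁆` of a linear functional `f`
on a complex Lie algebra `L`. -/
def kirillovKer {L : Type*} [LieRing L] [LieAlgebra ℂ L] (f : Module.Dual ℂ L) :
    Submodule ℂ L where
  carrier := {x | ∀ y, f ⁅x, y⁆ = 0}
  add_mem' {a b} ha hb := fun y => by rw [add_lie, map_add, ha y, hb y, add_zero]
  zero_mem' := fun y => by rw [zero_lie, map_zero]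
  smul_mem' c x hx := fun y => by rw [smul_lie, _root_.map_smul, hx y, smul_zero]

/-- The matrices commuting with `A`. -/
def commutant {m : Type*} [Fintype m] (A : Matrix m m ℂ) : Submodule ℂ (Matrix m m ℂ) :=
  LinearMap.ker (LinearMap.mulLeft ℂ A - LinearMap.mulRight ℂ A)

theorem mem_commutant {m : Type*} [Fintype m] {A X : Matrix m m ℂ} :
    X ∈ commutant A ↔ A * X = X * A := by
  simp [commutant, sub_eq_zero]

/-- A finitely generated torsion module over a PID embeds into its endomorphism module. -/
theorem exists_injective_to_end_of_isTorsion {R M : Type*} [CommRing R] [IsDomain R]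
    [IsPrincipalIdealRing R] [AddCommGroup M] [Module R M] [Module.Finite R M]
    (hM : Module.IsTorsion R M) :
    ∃ φ : M →ₗ[R] Module.End R M, Function.Injective φ := by
  classical
  obtain ⟨ι, _, p, -, e, ⟨E⟩⟩ := Module.equiv_directSum_of_isTorsion hM
  let E' : M ≃ₗ[R] (∀ i, R ⧸ Ideal.span {p i ^ e i}) :=
    E.trans (DirectSum.linearEquivFunOnFintype R ι fun i => R ⧸ Ideal.span {p i ^ e i})
  refine ⟨E'.symm.conj.toLinearMap ∘ₗ LinearMap.mul R _ ∘ₗ E'.toLinearMap, ?_⟩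
  have hmul : Function.Injective (LinearMap.mul R (∀ i, R ⧸ Ideal.span {p i ^ e i})) :=
    fun x y h => by simpa using LinearMap.congr_fun h 1
  exact E'.symm.conj.injective.comp (hmul.comp E'.injective)

theorem exists_injective_commuting {K V : Type*} [Field K] [AddCommGroup V] [Module K V]
    [FiniteDimensional K V] (f : Module.End K V) :
    ∃ φ : V →ₗ[K] Module.End K V, Function.Injective φ ∧ ∀ v, Commute f (φ v) := by
  obtain ⟨ψ, hψ⟩ := exists_injective_to_end_of_isTorsion
    (Module.AEval.isTorsion_of_finiteDimensional K V f)
  let o := Module.AEval.of K V f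
  refine ⟨{ toFun := fun v => o.symm.toLinearMap ∘ₗ (ψ (o v)).restrictScalars K ∘ₗ o.toLinearMap
            map_add' := fun v w => by ext; simp
            map_smul' := fun c v => by ext; simp }, ?_, ?_⟩
  · intro v w h
    apply o.injective
    apply hψ
    ext x
    have := LinearMap.congr_fun h (o.symm x)
    simpa using this
  · intro v
    ext x
    apply o.injective
    have h (y : V) : o (f y) = (Polynomial.X : Polynomial K) • o y :=
      (Module.AEval.X_smul_of f y).symm
    simp [h]

theorem card_le_finrank_commutant {m : Type*} [Fintype m] (A : Matrix m m ℂ) :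
    Fintype.card m ≤ Module.finrank ℂ (commutant A) := by
  classical
  obtain ⟨φ, hφ, hc⟩ := exists_injective_commuting (Matrix.toLin' A)
  let g : (m → ℂ) →ₗ[ℂ] commutant A :=
    (LinearMap.toMatrix'.toLinearMap ∘ₗ φ).codRestrict (commutant A) fun v => by
      have h := congrArg LinearMap.toMatrix' (hc v).eq
      rw [LinearMap.toMatrix'_mul, LinearMap.toMatrix'_mul, LinearMap.toMatrix'_toLin'] at h
      exact mem_commutant.2 h
  have hg : Function.Injective g := by
    intro v w h
    exact hφ (LinearMap.toMatrix'.injective (congrArg Subtype.val h))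
  simpa using LinearMap.finrank_le_finrank_of_injective hg

theorem finrank_commutant_diagonal_le {m : Type*} [Fintype m] [DecidableEq m] {d : m → ℂ}
    (hd : Function.Injective d) :
    Module.finrank ℂ (commutant (diagonal d)) ≤ Fintype.card m := by
  have hle : commutant (diagonal d) ≤ LinearMap.range (diagonalLinearMap m ℂ ℂ) := by
    intro X hX
    refine ⟨X.diag, ?_⟩
    ext i j
    by_cases hij : i = j
    · subst hij; simp
    · have h := congrFun (congrFun (mem_commutant.1 hX) i) j
      rw [diagonal_mul, mul_diagonal, mul_comm, ← sub_eq_zero, ← mul_sub, mul_eq_zero,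
        sub_eq_zero] at h
      simp [hij, h.resolve_right (hd.ne hij)]
  refine (Submodule.finrank_mono hle).trans ?_
  simpa using LinearMap.finrank_range_le (diagonalLinearMap m ℂ ℂ)

/-- The functional `X ↦ tr (A X)` on `sl`. -/
def slTraceDual {m : Type*} [Fintype m] [DecidableEq m] (A : Matrix m m ℂ) :
    Module.Dual ℂ (LieAlgebra.SpecialLinear.sl m ℂ) :=
  traceLinearMap m ℂ ℂ ∘ₗ LinearMap.mulLeft ℂ A ∘ₗ
    (LieAlgebra.SpecialLinear.sl m ℂ : Submodule ℂ (Matrix m m ℂ)).subtype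

theorem slTraceDual_apply {m : Type*} [Fintype m] [DecidableEq m] (A : Matrix m m ℂ)
    (X : LieAlgebra.SpecialLinear.sl m ℂ) : slTraceDual A X = trace (A * X.1) := rfl

theorem slTraceDual_surjective {m : Type*} [Fintype m] [DecidableEq m] :
    Function.Surjective (slTraceDual (m := m)) := by
  intro f
  obtain ⟨g, hg⟩ := LinearMap.exists_extend f
  refine ⟨of fun i j => g (single j i 1), ?_⟩
  have key : traceLinearMap m ℂ ℂ ∘ₗ LinearMap.mulLeft ℂ (of fun i j => g (single j i 1)) = g := by
    refine ext_linearMap ℂ fun i j => ?_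
    ext
    simp [trace_mul_single]
  ext X
  rw [slTraceDual_apply, ← hg]
  exact LinearMap.congr_fun key X.1

theorem mem_sl_iff {m : Type*} [Fintype m] [DecidableEq m] {X : Matrix m m ℂ} :
    X ∈ LieAlgebra.SpecialLinear.sl m ℂ ↔ trace X = 0 := Iff.rfl

theorem mem_kirillovKer_slTraceDual {m : Type*} [Fintype m] [DecidableEq m] [Nonempty m]
    {A : Matrix m m ℂ} {X : LieAlgebra.SpecialLinear.sl m ℂ} :
    X ∈ kirillovKer (slTraceDual A) ↔ X.1 ∈ commutant A := by
  have h (Y : Matrix m m ℂ) :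
      trace (A * (X.1 * Y - Y * X.1)) = trace ((A * X.1 - X.1 * A) * Y) := by
    rw [mul_sub, sub_mul, trace_sub, trace_sub, ← mul_assoc, ← mul_assoc,
      trace_mul_comm (A * Y) X.1, ← mul_assoc]
  have hker : X ∈ kirillovKer (slTraceDual A) ↔
      ∀ Y : LieAlgebra.SpecialLinear.sl m ℂ, trace ((A * X.1 - X.1 * A) * Y.1) = 0 :=
    forall_congr' fun Y => by
      rw [slTraceDual_apply, LieAlgebra.SpecialLinear.sl_bracket, h]
  rw [hker, mem_commutant]
  refine ⟨fun H => ?_, fun H Y => by simp [H]⟩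
  rw [← sub_eq_zero, Matrix.ext_iff_trace_mul_right]
  intro Y
  have hcard : (Fintype.card m : ℂ) ≠ 0 := Nat.cast_ne_zero.2 Fintype.card_ne_zero
  have hY : Y - (trace Y / Fintype.card m) • (1 : Matrix m m ℂ) ∈
      LieAlgebra.SpecialLinear.sl m ℂ := by
    rw [mem_sl_iff, trace_sub, trace_smul, trace_one, smul_eq_mul, div_mul_cancel₀ _ hcard,
      sub_self]
  have := H ⟨_, hY⟩
  rw [mul_sub, trace_sub, mul_smul_comm, mul_one, trace_smul, trace_sub, trace_mul_comm A,
    sub_self, smul_zero, sub_zero] at this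
  rw [this, zero_mul, trace_zero]

theorem finrank_kirillovKer_slTraceDual {m : Type*} [Fintype m] [DecidableEq m] [Nonempty m]
    (A : Matrix m m ℂ) :
    Module.finrank ℂ (kirillovKer (slTraceDual A)) + 1 = Module.finrank ℂ (commutant A) := by
  let t : commutant A →ₗ[ℂ] ℂ := (traceLinearMap m ℂ ℂ).domRestrict (commutant A)
  have ht : LinearMap.range t = ⊤ := by
    refine LinearMap.range_eq_top.2 (LinearMap.surjective fun h => ?_)
    have h1 := LinearMap.congr_fun h ⟨1, mem_commutant.2 (by simp)⟩
    simp [t] at h1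
  let e : kirillovKer (slTraceDual A) ≃ₗ[ℂ] LinearMap.ker t :=
    { toFun := fun X => ⟨⟨X.1.1, mem_kirillovKer_slTraceDual.1 X.2⟩, mem_sl_iff.1 X.1.2⟩
      invFun := fun X => ⟨⟨X.1.1, mem_sl_iff.2 X.2⟩, mem_kirillovKer_slTraceDual.2 X.1.2⟩
      map_add' := fun _ _ => rfl
      map_smul' := fun _ _ => rfl
      left_inv := fun _ => rfl
      right_inv := fun _ => rfl }
  rw [e.finrank_eq, ← LinearMap.finrank_range_add_finrank_ker t, ht, finrank_top,
    Module.finrank_self, add_comm]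

/-- The index of `sl(n+1, ℂ)` equals `n`: the minimum, over all linear functionals `f` on
the Lie algebra of traceless `(n+1) × (n+1)` complex matrices, of `dim ker B_f` is `n`. -/
theorem index_sl_eq (n : ℕ) (hn : 1 ≤ n) :
    IsLeast
      (Set.range fun f : Module.Dual ℂ ↥(LieAlgebra.SpecialLinear.sl (Fin (n + 1)) ℂ) =>
        Module.finrank ℂ (kirillovKer f)) n := by
  have lower (A : Matrix (Fin (n + 1)) (Fin (n + 1)) ℂ) :
      n ≤ Module.finrank ℂ (kirillovKer (slTraceDual A)) := by
    have h := card_le_finrank_commutant A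
    rw [← finrank_kirillovKer_slTraceDual, Fintype.card_fin] at h
    omega
  constructor
  · let d : Fin (n + 1) → ℂ := fun i => ((i : ℕ) : ℂ)
    have hd : Function.Injective d := Nat.cast_injective.comp Fin.val_injective
    refine ⟨slTraceDual (diagonal d), le_antisymm ?_ (lower _)⟩
    have h := finrank_commutant_diagonal_le hd
    rw [← finrank_kirillovKer_slTraceDual, Fintype.card_fin] at h
    simpa using h
  · rintro _ ⟨f, rfl⟩
    obtain ⟨A, rfl⟩ := slTraceDual_surjective f
    exact lower A
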